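/- Let w : [0,∞) → ℝ^N be a regular reparametrized gradient flow under Assumptions (B1), (A2), (A3), (B2). If sup_{t ≥ 0} ‖w̃(t)‖₂ < ∞, then the limit w̃_∞ := lim_{t→∞} w̃(t) exists in the closure of D_rp^N and satisfies 𝓛̃(w̃_∞) = 0. -/

import Mathlib

open Filter Topology Set
open scoped ENNReal

noncomputable section

/-- Euclidean gradient of `f : ℝ^k → ℝ`: coordinatewise the Fréchet derivative applied to
the standard basis vectors. -/
def grad {k : ℕ} (f : (Fin k → ℝ) → ℝ) (x : Fin k → ℝ) : Fin k → ℝ :=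
  fun i => fderiv ℝ f x (Pi.single i 1)

/-- `w` solves the gradient-flow ODE `w' = -∇F(w)` on `[0, T)`, where `T ∈ (0, ∞]` is coded
as an element of `ℝ≥0∞`. -/
def IsGradFlowOn {k : ℕ} (F : (Fin k → ℝ) → ℝ) (T : ℝ≥0∞) (w : ℝ → Fin k → ℝ) : Prop :=
  ∀ t : ℝ, 0 ≤ t → ENNReal.ofReal t < T →
    HasDerivWithinAt w (-(grad F (w t))) (Set.Ici 0) t

/-- A reparametrized flow is regular if `ρ'` vanishes at some coordinate of `w t` for only
finitely many times `t` in the domain `[0, T)`. -/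
def RegularFlow {k : ℕ} (ρ : ℝ → ℝ) (T : ℝ≥0∞) (w : ℝ → Fin k → ℝ) : Prop :=
  {t : ℝ | 0 ≤ t ∧ ENNReal.ofReal t < T ∧ ∃ i, deriv ρ (w t i) = 0}.Finite

/-- The filter of "`t → T` from within `[0,T)`", with `T = ∞` meaning `t → ∞`. -/
def endFilter (T : ℝ≥0∞) : Filter ℝ :=
  if T = ⊤ then Filter.atTop else nhdsWithin T.toReal (Set.Iio T.toReal)

/-- Entrywise ℓp-norm on `ℝ^k`. -/
def lpNorm {k : ℕ} (p : ℝ) (z : Fin k → ℝ) : ℝ := (∑ i, |z i| ^ p) ^ (1 / p)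

/-- Euclidean norm on `ℝ^k`. -/
def euclNorm {k : ℕ} (z : Fin k → ℝ) : ℝ := Real.sqrt (∑ i, (z i) ^ 2)

/-- Bregman divergence associated with `F(z) = ∑ i, H (z i)`, whose gradient is `h = H'`
applied entrywise. -/
def bregman {k : ℕ} (H h : ℝ → ℝ) (p q : Fin k → ℝ) : ℝ :=
  (∑ i, H (p i)) - (∑ i, H (q i)) - ∑ i, h (q i) * (p i - q i)

/-- Assumption (A3) on the loss function: continuously differentiable, convex in the first
argument, with minimum `0` attained exactly on the diagonal. -/
structure LossA3 {m : ℕ} (L : (Fin m → ℝ) → (Fin m → ℝ) → ℝ) : Prop where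
  contDiff : ContDiff ℝ 1 (Function.uncurry L)
  convexOn_fst : ∀ y, ConvexOn ℝ Set.univ fun z => L z y
  nonneg : ∀ z z', 0 ≤ L z z'
  eq_zero_iff : ∀ z z', L z z' = 0 ↔ z = z'

/-- Assumption (A1) on the link function. -/
structure LinkA1 {m : ℕ} (ρlink : ℝ → ℝ) (y : Fin m → ℝ) : Prop where
  contDiff : ContDiff ℝ 1 ρlink
  injective : Function.Injective ρlink
  mem_image : ∀ j, ∃ x : ℝ, ρlink x = y j

/-- Assumption (A2) on the reparametrization `ρ : ℝ → D` with inverse `ρinv`: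
continuously differentiable and invertible, derivative nonzero outside a finite set, and
`([ρ⁻¹]')²` integrable on every compact subset of `D`. -/
structure RepA2 (ρ : ℝ → ℝ) (D : Set ℝ) (ρinv : ℝ → ℝ) : Prop where
  contDiff : ContDiff ℝ 1 ρ
  mapsTo : ∀ x : ℝ, ρ x ∈ D
  left_inv : ∀ x : ℝ, ρinv (ρ x) = x
  right_inv : ∀ z ∈ D, ρ (ρinv z) = z
  finite_critical : {x : ℝ | deriv ρ x = 0}.Finite
  loc_integrable : ∀ C : Set ℝ, C ⊆ D → IsCompact C →
    MeasureTheory.IntegrableOn (fun z => (deriv ρinv z) ^ 2) C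

open MeasureTheory

/-- A continuous function whose derivative is nonpositive off a finite set does not increase. -/
lemma le_of_hasDerivAt_nonpos_off_finite {f f' : ℝ → ℝ} {S : Set ℝ} (hS : S.Finite) {a b : ℝ}
    (hab : a ≤ b) (hf : ContinuousOn f (Icc a b))
    (hd : ∀ t ∈ Ioo a b, t ∉ S → HasDerivAt f (f' t) t)
    (hnonpos : ∀ t ∈ Ioo a b, t ∉ S → f' t ≤ 0) : f b ≤ f a := by
  induction S, hS using Set.Finite.induction_on generalizing a b with
  | empty =>
    refine antitoneOn_of_deriv_nonpos (convex_Icc a b) hf ?_ ?_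
      (left_mem_Icc.2 hab) (right_mem_Icc.2 hab) hab
    · rw [interior_Icc]
      exact fun t ht => (hd t ht (notMem_empty t)).differentiableAt.differentiableWithinAt
    · rw [interior_Icc]
      intro t ht
      rw [(hd t ht (notMem_empty t)).deriv]
      exact hnonpos t ht (notMem_empty t)
  | @insert x S _ _ ih =>
    by_cases hx : x ∈ Ioo a b
    · have h1 : f x ≤ f a := by
        refine ih hx.1.le (hf.mono (Icc_subset_Icc_right hx.2.le)) ?_ ?_ <;>
        · intro t ht htS
          have : t ∉ insert x S := by
            rintro (h | h)
            exacts [ht.2.ne h, htS h]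
          first
          | exact hd t ⟨ht.1, ht.2.trans hx.2⟩ this
          | exact hnonpos t ⟨ht.1, ht.2.trans hx.2⟩ this
      have h2 : f b ≤ f x := by
        refine ih hx.2.le (hf.mono (Icc_subset_Icc_left hx.1.le)) ?_ ?_ <;>
        · intro t ht htS
          have : t ∉ insert x S := by
            rintro (h | h)
            exacts [ht.1.ne' h, htS h]
          first
          | exact hd t ⟨hx.1.trans ht.1, ht.2⟩ this
          | exact hnonpos t ⟨hx.1.trans ht.1, ht.2⟩ this
      exact h2.trans h1
    · refine ih hab hf ?_ ?_ <;>
      · intro t ht htS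
        have : t ∉ insert x S := by
          rintro (h | h)
          exacts [hx (h ▸ ht), htS h]
        first
        | exact hd t ht this
        | exact hnonpos t ht this

/-- The first-order characterization of convexity for a Fréchet derivative. -/
lemma ConvexOn.fderiv_sub_le {E : Type*} [NormedAddCommGroup E] [NormedSpace ℝ E]
    {f : E → ℝ} (hf : ConvexOn ℝ univ f) {x : E} (hd : DifferentiableAt ℝ f x) (z : E) :
    fderiv ℝ f x (z - x) ≤ f z - f x := by
  have hc : ConvexOn ℝ univ (f ∘ AffineMap.lineMap (k := ℝ) x z) :=
    hf.comp_affineMap (AffineMap.lineMap (k := ℝ) x z)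
  have hder : HasDerivAt (f ∘ AffineMap.lineMap (k := ℝ) x z) (fderiv ℝ f x (z - x)) 0 := by
    have h0 : HasFDerivAt f (fderiv ℝ f x) (AffineMap.lineMap (k := ℝ) x z (0 : ℝ)) := by
      simpa using hd.hasFDerivAt
    exact h0.comp_hasDerivAt (0 : ℝ) AffineMap.hasDerivAt_lineMap
  simpa [slope_def_field] using
    hc.le_slope_of_hasDerivAt (mem_univ 0) (mem_univ 1) one_pos hder

/-- The Bregman divergence of the reparametrized flow as a function of the unparametrized
variable. -/
def potential (ρ : ℝ → ℝ) (b x : ℝ) : ℝ := ∫ s in b..x, (ρ s - ρ b) / deriv ρ s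

/-- The local integrability of `([ρ⁻¹]')²` amounts to that of `1 / ρ'`. -/
lemma RepA2.intervalIntegrable_inv_deriv {ρ ρinv : ℝ → ℝ} {D : Set ℝ} (h : RepA2 ρ D ρinv)
    (a b : ℝ) : IntervalIntegrable (fun s => (deriv ρ s)⁻¹) volume a b := by
  have hinj : Function.Injective ρ := Function.LeftInverse.injective h.left_inv
  have hd : ∀ x, HasStrictDerivAt ρ (deriv ρ x) x := fun x =>
    (h.contDiff.contDiffAt).hasStrictDerivAt one_ne_zero
  have himg : IntegrableOn (fun z => (deriv ρinv z) ^ 2) (ρ '' uIcc a b) := by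
    refine h.loc_integrable _ ?_ (isCompact_uIcc.image h.contDiff.continuous)
    rintro _ ⟨x, -, rfl⟩
    exact h.mapsTo x
  rw [integrableOn_image_iff_integrableOn_abs_deriv_smul measurableSet_uIcc
    (fun x _ => (hd x).hasDerivAt.hasDerivWithinAt) hinj.injOn] at himg
  have hint : IntegrableOn (fun s => (deriv ρ s)⁻¹) (uIcc a b) := by
    have hm : Measurable fun s => (deriv ρ s)⁻¹ := (measurable_deriv ρ).inv
    refine Integrable.mono himg hm.aestronglyMeasurable (Eventually.of_forall fun s => ?_)
    by_cases hs : deriv ρ s = 0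
    · simp [hs]
    · have hinv : deriv ρinv (ρ s) = (deriv ρ s)⁻¹ :=
        ((hd s).to_local_left_inverse hs (Eventually.of_forall h.left_inv)).hasDerivAt.deriv
      have hpos : |deriv ρ s| ≠ 0 := abs_ne_zero.2 hs
      rw [hinv, smul_eq_mul, Real.norm_eq_abs, Real.norm_eq_abs, abs_mul, abs_abs, abs_pow,
        abs_inv]
      field_simp
      exact le_rfl
  exact hint.intervalIntegrable

section Potential

variable {ρ : ℝ → ℝ}

lemma intervalIntegrable_potential_integrand (hρ : ContDiff ℝ 1 ρ)
    (hint : ∀ a b, IntervalIntegrable (fun s => (deriv ρ s)⁻¹) volume a b) (b u v : ℝ) :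
    IntervalIntegrable (fun s => (ρ s - ρ b) / deriv ρ s) volume u v := by
  simp only [div_eq_mul_inv]
  exact (hint u v).continuousOn_mul (hρ.continuous.sub continuous_const).continuousOn

lemma continuous_potential (hρ : ContDiff ℝ 1 ρ)
    (hint : ∀ a b, IntervalIntegrable (fun s => (deriv ρ s)⁻¹) volume a b) (b : ℝ) :
    Continuous (potential ρ b) :=
  intervalIntegral.continuous_primitive (intervalIntegrable_potential_integrand hρ hint b) b

lemma hasDerivAt_potential (hρ : ContDiff ℝ 1 ρ)
    (hint : ∀ a b, IntervalIntegrable (fun s => (deriv ρ s)⁻¹) volume a b) (b : ℝ) {x : ℝ}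
    (hx : deriv ρ x ≠ 0) :
    HasDerivAt (potential ρ b) ((ρ x - ρ b) / deriv ρ x) x := by
  refine intervalIntegral.integral_hasDerivAt_right
    (intervalIntegrable_potential_integrand hρ hint b b x) ?_ ?_
  · refine (Measurable.stronglyMeasurable ?_).stronglyMeasurableAtFilter
    exact (hρ.continuous.measurable.sub_const _).div (measurable_deriv ρ)
  · exact (hρ.continuous.continuousAt.sub continuousAt_const).div
      (hρ.continuous_deriv le_rfl).continuousAt hx

/-- If `f` dominates `δ / ρ'`, its integral over `[c, x]` is bounded below quadratically in the
length of the interval. -/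
lemma le_integral_of_div_deriv_le (hρ : ContDiff ℝ 1 ρ) (hmono : StrictMono ρ)
    (hcrit : {x : ℝ | deriv ρ x = 0}.Finite) {f : ℝ → ℝ} {c x δ R : ℝ} (hcx : c ≤ x)
    (hδ : 0 ≤ δ) (hR : 0 < R) (hρR : ρ x - ρ c ≤ R)
    (hf : IntervalIntegrable f volume c x) (hle : ∀ s ∈ Icc c x, δ / deriv ρ s ≤ f s) :
    δ * (x - c) ^ 2 / R ≤ ∫ s in c..x, f s := by
  set k := (x - c) / R with hk
  have hderiv : Continuous (deriv ρ) := hρ.continuous_deriv le_rfl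
  have hftc : ∫ s in c..x, deriv ρ s = ρ x - ρ c :=
    intervalIntegral.integral_deriv_eq_sub
      (fun s _ => (hρ.differentiable one_ne_zero) s) (hderiv.intervalIntegrable c x)
  have hval : ∫ s in c..x, δ * (2 * k - k ^ 2 * deriv ρ s)
      = δ * (2 * k * (x - c) - k ^ 2 * (ρ x - ρ c)) := by
    rw [intervalIntegral.integral_const_mul, intervalIntegral.integral_sub
      intervalIntegrable_const ((hderiv.intervalIntegrable c x).const_mul (k ^ 2)),
      intervalIntegral.integral_const_mul (k ^ 2), hftc, intervalIntegral.integral_const]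
    simp only [smul_eq_mul]
    ring
  have hmono' : ∫ s in c..x, δ * (2 * k - k ^ 2 * deriv ρ s) ≤ ∫ s in c..x, f s := by
    refine intervalIntegral.integral_mono_ae_restrict hcx
      (Continuous.intervalIntegrable (by fun_prop) c x) hf ?_
    have hae : ∀ᵐ s ∂(volume.restrict (Icc c x)), s ∉ {x : ℝ | deriv ρ x = 0} :=
      ae_restrict_of_ae (measure_eq_zero_iff_ae_notMem.1 (hcrit.measure_zero volume))
    filter_upwards [hae, ae_restrict_mem measurableSet_Icc] with s hs hsI
    have hpos : 0 < deriv ρ s :=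
      lt_of_le_of_ne hmono.monotone.deriv_nonneg (fun h => hs h.symm)
    refine le_trans ?_ (hle s hsI)
    rw [div_eq_mul_inv]
    refine mul_le_mul_of_nonneg_left ?_ hδ
    have hsq : (deriv ρ s)⁻¹ - (2 * k - k ^ 2 * deriv ρ s)
        = (deriv ρ s)⁻¹ * (1 - k * deriv ρ s) ^ 2 := by
      field_simp
      ring
    have : 0 ≤ (deriv ρ s)⁻¹ * (1 - k * deriv ρ s) ^ 2 := by positivity
    linarith
  refine le_trans ?_ hmono'
  rw [hval, mul_div_assoc]
  refine mul_le_mul_of_nonneg_left ?_ hδ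
  have h1 : k ^ 2 * (ρ x - ρ c) ≤ k ^ 2 * R := mul_le_mul_of_nonneg_left hρR (sq_nonneg k)
  have h2 : 2 * k * (x - c) - k ^ 2 * R = (x - c) ^ 2 / R := by
    rw [hk]
    field_simp
    ring
  linarith

lemma le_potential_of_lt (hρ : ContDiff ℝ 1 ρ) (hmono : StrictMono ρ)
    (hcrit : {x : ℝ | deriv ρ x = 0}.Finite)
    (hint : ∀ a b, IntervalIntegrable (fun s => (deriv ρ s)⁻¹) volume a b)
    {b c x R : ℝ} (hbc : b ≤ c) (hcx : c ≤ x) (hR : 0 < R) (hρR : ρ x - ρ c ≤ R) :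
    (ρ c - ρ b) * (x - c) ^ 2 / R ≤ potential ρ b x := by
  have hI := intervalIntegrable_potential_integrand hρ hint b
  have h1 : 0 ≤ ∫ s in b..c, (ρ s - ρ b) / deriv ρ s :=
    intervalIntegral.integral_nonneg hbc fun s hs =>
      div_nonneg (sub_nonneg.2 (hmono.monotone hs.1)) hmono.monotone.deriv_nonneg
  have h2 : (ρ c - ρ b) * (x - c) ^ 2 / R ≤ ∫ s in c..x, (ρ s - ρ b) / deriv ρ s :=
    le_integral_of_div_deriv_le hρ hmono hcrit hcx (sub_nonneg.2 (hmono.monotone hbc)) hR hρR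
      (hI c x) fun s hs => div_le_div_of_nonneg_right
        (sub_le_sub_right (hmono.monotone hs.1) _) hmono.monotone.deriv_nonneg
  have h3 := intervalIntegral.integral_add_adjacent_intervals (hI b c) (hI c x)
  unfold potential
  linarith

lemma le_potential_of_gt (hρ : ContDiff ℝ 1 ρ) (hmono : StrictMono ρ)
    (hcrit : {x : ℝ | deriv ρ x = 0}.Finite)
    (hint : ∀ a b, IntervalIntegrable (fun s => (deriv ρ s)⁻¹) volume a b)
    {b c x R : ℝ} (hcb : c ≤ b) (hxc : x ≤ c) (hR : 0 < R) (hρR : ρ c - ρ x ≤ R) :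
    (ρ b - ρ c) * (c - x) ^ 2 / R ≤ potential ρ b x := by
  have hI := intervalIntegrable_potential_integrand hρ hint b
  have h1 : 0 ≤ ∫ s in c..b, -((ρ s - ρ b) / deriv ρ s) :=
    intervalIntegral.integral_nonneg hcb fun s hs => by
      rw [← neg_div, neg_sub]
      exact div_nonneg (sub_nonneg.2 (hmono.monotone hs.2)) hmono.monotone.deriv_nonneg
  have h2 : (ρ b - ρ c) * (c - x) ^ 2 / R ≤ ∫ s in x..c, -((ρ s - ρ b) / deriv ρ s) :=
    le_integral_of_div_deriv_le hρ hmono hcrit hxc (sub_nonneg.2 (hmono.monotone hcb)) hR hρR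
      (hI x c).neg fun s hs => by
        rw [← neg_div, neg_sub]
        exact div_le_div_of_nonneg_right
          (sub_le_sub_left (hmono.monotone hs.2) _) hmono.monotone.deriv_nonneg
  have h3 := intervalIntegral.integral_add_adjacent_intervals (hI b c) (hI c x)
  rw [intervalIntegral.integral_neg] at h1 h2
  rw [intervalIntegral.integral_symm b c] at h1
  rw [intervalIntegral.integral_symm c x] at h2
  unfold potential
  linarith

lemma potential_nonneg (hmono : StrictMono ρ) (b x : ℝ) : 0 ≤ potential ρ b x := by
  unfold potential
  rcases le_total b x with h | h
  · exact intervalIntegral.integral_nonneg h fun s hs =>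
      div_nonneg (sub_nonneg.2 (hmono.monotone hs.1)) hmono.monotone.deriv_nonneg
  · rw [intervalIntegral.integral_symm, ← intervalIntegral.integral_neg]
    exact intervalIntegral.integral_nonneg h fun s hs => by
      rw [← neg_div, neg_sub]
      exact div_nonneg (sub_nonneg.2 (hmono.monotone hs.2)) hmono.monotone.deriv_nonneg

/-- Where `ρ` is bounded, the potential dominates a multiple of the squared distance to `b`,
as long as this distance is at least `2 * ε`. -/
lemma exists_sq_le_potential (hρ : ContDiff ℝ 1 ρ) (hmono : StrictMono ρ)
    (hcrit : {x : ℝ | deriv ρ x = 0}.Finite)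
    (hint : ∀ a b, IntervalIntegrable (fun s => (deriv ρ s)⁻¹) volume a b)
    (b C : ℝ) {ε : ℝ} (hε : 0 < ε) :
    ∃ κ > 0, ∀ x, |ρ x| ≤ C → 2 * ε ≤ |x - b| → κ * (|x - b| - ε) ^ 2 ≤ potential ρ b x := by
  set R := C + |ρ (b + ε)| + |ρ (b - ε)| + 1 + |C| with hRdef
  have hR : 0 < R := by
    have := neg_abs_le C
    have := abs_nonneg (ρ (b + ε))
    have := abs_nonneg (ρ (b - ε))
    linarith
  have hr : 0 < ρ (b + ε) - ρ b := sub_pos.2 (hmono (by linarith))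
  have hl : 0 < ρ b - ρ (b - ε) := sub_pos.2 (hmono (by linarith))
  refine ⟨min (ρ (b + ε) - ρ b) (ρ b - ρ (b - ε)) / R, div_pos (lt_min hr hl) hR,
    fun x hxC hx => ?_⟩
  have hxC' := abs_le.1 hxC
  have e1 := abs_le.1 (le_refl |ρ (b + ε)|)
  have e2 := abs_le.1 (le_refl |ρ (b - ε)|)
  have e3 := abs_nonneg C
  rw [div_mul_eq_mul_div]
  rcases le_total b x with h | h
  · rw [abs_of_nonneg (sub_nonneg.2 h)] at hx ⊢
    have := le_potential_of_lt hρ hmono hcrit hint (b := b) (c := b + ε) (x := x) (R := R)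
      (by linarith) (by linarith) hR (by linarith [abs_nonneg (ρ (b - ε))])
    refine le_trans ?_ this
    rw [show x - b - ε = x - (b + ε) by ring]
    gcongr
    exact min_le_left _ _
  · rw [abs_of_nonpos (sub_nonpos.2 h)] at hx ⊢
    have := le_potential_of_gt hρ hmono hcrit hint (b := b) (c := b - ε) (x := x) (R := R)
      (by linarith) (by linarith) hR (by linarith [abs_nonneg (ρ (b + ε))])
    refine le_trans ?_ this
    rw [show -(x - b) - ε = b - ε - x by ring]
    gcongr
    exact min_le_right _ _

end Potential

section Flow

variable {N : ℕ} {ρ : ℝ → ℝ} {G : (Fin N → ℝ) → ℝ} {w : ℝ → Fin N → ℝ}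

lemma ContinuousLinearMap.apply_eq_sum_single (ℓ : (Fin N → ℝ) →L[ℝ] ℝ) (u : Fin N → ℝ) :
    ℓ u = ∑ i, u i * ℓ (Pi.single i 1) := by
  conv_lhs => rw [pi_eq_sum_univ' u, map_sum]
  refine Finset.sum_congr rfl fun i _ => ?_
  rw [map_smul, smul_eq_mul]

lemma hasFDerivAt_entrywise (hρ : ContDiff ℝ 1 ρ) (hG : ContDiff ℝ 1 G) (x : Fin N → ℝ) :
    HasFDerivAt (fun z : Fin N → ℝ => G fun i => ρ (z i))
      ((fderiv ℝ G fun i => ρ (x i)).comp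
        (ContinuousLinearMap.pi fun i => deriv ρ (x i) • ContinuousLinearMap.proj i)) x := by
  have hin : HasFDerivAt (fun z : Fin N → ℝ => fun i => ρ (z i))
      (ContinuousLinearMap.pi fun i => deriv ρ (x i) •
        ContinuousLinearMap.proj (R := ℝ) (φ := fun _ : Fin N => ℝ) i) x := by
    refine hasFDerivAt_pi.2 fun i => ?_
    exact ((hρ.differentiable one_ne_zero) (x i)).hasDerivAt.comp_hasFDerivAt x
      (hasFDerivAt_apply i x)
  exact ((hG.differentiable one_ne_zero) _).hasFDerivAt.comp x hin

lemma grad_entrywise (hρ : ContDiff ℝ 1 ρ) (hG : ContDiff ℝ 1 G) (x : Fin N → ℝ) (i : Fin N) :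
    grad (fun z => G fun i => ρ (z i)) x i
      = deriv ρ (x i) * fderiv ℝ G (fun i => ρ (x i)) (Pi.single i 1) := by
  rw [grad, (hasFDerivAt_entrywise hρ hG x).fderiv, ContinuousLinearMap.comp_apply,
    ← smul_eq_mul, ← map_smul]
  congr 1
  ext j
  by_cases h : j = i
  · subst h; simp
  · simp [h]

lemma IsGradFlowOn.hasDerivAt {F : (Fin N → ℝ) → ℝ} (h : IsGradFlowOn F ⊤ w) {t : ℝ}
    (ht : 0 < t) : HasDerivAt w (-(grad F (w t))) t :=
  (h t ht.le ENNReal.ofReal_lt_top).hasDerivAt (Ici_mem_nhds ht)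

lemma IsGradFlowOn.continuousOn {F : (Fin N → ℝ) → ℝ} (h : IsGradFlowOn F ⊤ w) :
    ContinuousOn w (Ici 0) :=
  fun t ht => (h t ht ENNReal.ofReal_lt_top).continuousWithinAt

/-- The objective does not increase along its gradient flow. -/
lemma IsGradFlowOn.antitoneOn {F : (Fin N → ℝ) → ℝ} (h : IsGradFlowOn F ⊤ w)
    (hF : Differentiable ℝ F) : AntitoneOn (fun t => F (w t)) (Ici 0) := by
  have hd : ∀ t > 0, HasDerivAt (fun t => F (w t)) (fderiv ℝ F (w t) (-(grad F (w t)))) t :=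
    fun t ht => (hF (w t)).hasFDerivAt.comp_hasDerivAt t (h.hasDerivAt ht)
  refine antitoneOn_of_deriv_nonpos (convex_Ici 0)
    (hF.continuous.comp_continuousOn h.continuousOn) ?_ ?_
  · rw [interior_Ici]
    exact fun t ht => (hd t ht).differentiableAt.differentiableWithinAt
  · rw [interior_Ici]
    intro t ht
    rw [(hd t ht).deriv, map_neg, ContinuousLinearMap.apply_eq_sum_single, neg_nonpos]
    exact Finset.sum_nonneg fun i _ => mul_self_nonneg (grad F (w t) i)

/-- The total potential with respect to a global minimizer decreases along the flow, at a rate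
given by the objective. -/
lemma sum_potential_add_le (hρ : ContDiff ℝ 1 ρ)
    (hint : ∀ a b, IntervalIntegrable (fun s => (deriv ρ s)⁻¹) volume a b)
    (hG : ContDiff ℝ 1 G) (hconv : ConvexOn ℝ univ G)
    (hflow : IsGradFlowOn (fun z => G fun i => ρ (z i)) ⊤ w) (hreg : RegularFlow ρ ⊤ w)
    {b : Fin N → ℝ} (hb : G (fun i => ρ (b i)) = 0) {s t : ℝ} (hs : 0 ≤ s) (hst : s ≤ t) :
    (∑ i, potential ρ (b i) (w t i)) + (t - s) * G (fun i => ρ (w t i))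
      ≤ ∑ i, potential ρ (b i) (w s i) := by
  set g := G (fun i => ρ (w t i)) with hg
  have hanti := hflow.antitoneOn fun x => (hasFDerivAt_entrywise hρ hG x).differentiableAt
  have hw : ∀ i, ContinuousOn (fun r => w r i) (Icc s t) := fun i =>
    (continuous_apply i).comp_continuousOn
      (hflow.continuousOn.mono fun r hr => hs.trans hr.1)
  have key : (fun r => (∑ i, potential ρ (b i) (w r i)) + (r - s) * g) t
      ≤ (fun r => (∑ i, potential ρ (b i) (w r i)) + (r - s) * g) s := by
    refine le_of_hasDerivAt_nonpos_off_finite hreg hst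
      (f := fun r => (∑ i, potential ρ (b i) (w r i)) + (r - s) * g)
      (f' := fun r => fderiv ℝ G (fun i => ρ (w r i))
        ((fun i => ρ (b i)) - fun i => ρ (w r i)) + g) ?_ ?_ ?_
    · refine ContinuousOn.add (continuousOn_finsetSum _ fun i _ => ?_) (by fun_prop)
      exact (continuous_potential hρ hint (b i)).comp_continuousOn (hw i)
    · intro r hr hrS
      have hr0 : 0 < r := hs.trans_lt hr.1
      have hne : ∀ i, deriv ρ (w r i) ≠ 0 := fun i hi =>
        hrS ⟨hr0.le, ENNReal.ofReal_lt_top, i, hi⟩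
      have hwi := hasDerivAt_pi.1 (hflow.hasDerivAt hr0)
      have hlin : HasDerivAt (fun r => (r - s) * g) g r := by
        simpa using ((hasDerivAt_id r).sub_const s).mul_const g
      refine HasDerivAt.add ?_ hlin
      rw [ContinuousLinearMap.apply_eq_sum_single]
      refine HasDerivAt.fun_sum fun i _ => ?_
      refine ((hasDerivAt_potential hρ hint (b i) (hne i)).comp r (hwi i)).congr_deriv ?_
      rw [Pi.neg_apply, grad_entrywise hρ hG, Pi.sub_apply]
      field_simp [hne i]
      ring
    · intro r hr _
      have h1 := hconv.fderiv_sub_le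
        ((hG.differentiable one_ne_zero) fun i => ρ (w r i)) (fun i => ρ (b i))
      have h2 : g ≤ G fun i => ρ (w r i) :=
        hanti (hs.trans hr.1.le) (hs.trans hst) hr.2.le
      rw [hb] at h1
      linarith
  simpa using key

/-- Convergence of a reparametrized gradient flow with increasing reparametrization. -/
lemma exists_tendsto_of_strictMono (hρ : ContDiff ℝ 1 ρ) (hmono : StrictMono ρ)
    (hcrit : {x : ℝ | deriv ρ x = 0}.Finite)
    (hint : ∀ a b, IntervalIntegrable (fun s => (deriv ρ s)⁻¹) volume a b)
    (hG : ContDiff ℝ 1 G) (hconv : ConvexOn ℝ univ G) (hG0 : ∀ z, 0 ≤ G z)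
    (hflow : IsGradFlowOn (fun z => G fun i => ρ (z i)) ⊤ w) (hreg : RegularFlow ρ ⊤ w)
    {b : Fin N → ℝ} (hb : G (fun i => ρ (b i)) = 0) {C : ℝ}
    (hC : ∀ t, 0 ≤ t → ∀ i, |ρ (w t i)| ≤ C) :
    ∃ x : Fin N → ℝ, Tendsto w atTop (𝓝 x) ∧ G (fun i => ρ (x i)) = 0 := by
  have hdecr := fun {b : Fin N → ℝ} (hb : G (fun i => ρ (b i)) = 0) {s t : ℝ} (hs : 0 ≤ s)
    (hst : s ≤ t) => sum_potential_add_le hρ hint hG hconv hflow hreg hb hs hst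
  have hsingle : ∀ (b : Fin N → ℝ) (t : ℝ) (i : Fin N),
      potential ρ (b i) (w t i) ≤ ∑ i, potential ρ (b i) (w t i) := fun b t i =>
    Finset.single_le_sum (f := fun i => potential ρ (b i) (w t i))
      (fun j _ => potential_nonneg hmono (b j) (w t j)) (Finset.mem_univ i)
  set V := ∑ i, potential ρ (b i) (w 0 i) with hV
  have hloss : Tendsto (fun t => G fun i => ρ (w t i)) atTop (𝓝 0) := by
    refine tendsto_of_tendsto_of_tendsto_of_le_of_le' tendsto_const_nhds
      (tendsto_const_nhds.div_atTop tendsto_id : Tendsto (fun t : ℝ => V / id t) atTop (𝓝 0))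
      (Eventually.of_forall fun t => hG0 _) ?_
    filter_upwards [eventually_gt_atTop 0] with t ht
    have h1 := hdecr hb le_rfl ht.le
    have h2 : 0 ≤ ∑ i, potential ρ (b i) (w t i) :=
      Finset.sum_nonneg fun i _ => potential_nonneg hmono _ _
    rw [id, le_div_iff₀ ht]
    linarith
  have hbdd : ∀ i, ∃ K, ∀ t, 0 ≤ t → |w t i| ≤ K := by
    intro i
    obtain ⟨κ, hκ, h⟩ := exists_sq_le_potential hρ hmono hcrit hint (b i) C one_pos
    refine ⟨|b i| + (2 + V / κ), fun t ht => ?_⟩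
    have hVt : potential ρ (b i) (w t i) ≤ V := by
      have h1 := hdecr hb le_rfl ht
      have h2 := mul_nonneg ht (hG0 fun i => ρ (w t i))
      have h3 := hsingle b t i
      linarith
    have hV0 : 0 ≤ V / κ := div_nonneg ((potential_nonneg hmono _ _).trans hVt) hκ.le
    have htri : |w t i| ≤ |b i| + |w t i - b i| := by
      simpa using abs_add_le (b i) (w t i - b i)
    by_cases hfar : 2 * 1 ≤ |w t i - b i|
    · have h1 := (h (w t i) (hC t ht i) hfar).trans hVt
      have h2 : (|w t i - b i| - 1) ^ 2 ≤ V / κ := by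
        rw [le_div_iff₀ hκ]
        linarith
      nlinarith
    · linarith [not_le.1 hfar]
  choose K hK using hbdd
  obtain ⟨x, -, φ, hφ, hlim⟩ := tendsto_subseq_of_bounded
    (s := Set.pi univ fun i => Icc (-K i) (K i))
    (isCompact_univ_pi fun i => isCompact_Icc).isBounded
    (x := fun n : ℕ => w n) fun n i _ => abs_le.1 (hK i n n.cast_nonneg)
  have hφtop : Tendsto (fun n => ((φ n : ℕ) : ℝ)) atTop atTop :=
    tendsto_natCast_atTop_atTop.comp hφ.tendsto_atTop
  have hx : G (fun i => ρ (x i)) = 0 := by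
    have hcont : Continuous fun z : Fin N → ℝ => G fun i => ρ (z i) :=
      hG.continuous.comp (continuous_pi fun i => hρ.continuous.comp (continuous_apply i))
    exact tendsto_nhds_unique ((hcont.tendsto x).comp hlim) (hloss.comp hφtop)
  have hpot : Tendsto (fun n => ∑ i, potential ρ (x i) (w (φ n) i)) atTop (𝓝 0) := by
    have hcont : Continuous fun z : Fin N → ℝ => ∑ i, potential ρ (x i) (z i) :=
      continuous_finsetSum _ fun i _ =>
        (continuous_potential hρ hint (x i)).comp (continuous_apply i)
    have h := (hcont.tendsto x).comp hlim
    have h0 : ∑ i, potential ρ (x i) (x i) = 0 :=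
      Finset.sum_eq_zero fun i _ => intervalIntegral.integral_same
    rwa [h0] at h
  refine ⟨x, tendsto_pi_nhds.2 fun i => Metric.tendsto_atTop.2 fun ε hε => ?_, hx⟩
  obtain ⟨κ, hκ, h⟩ := exists_sq_le_potential hρ hmono hcrit hint (x i) C (half_pos hε)
  obtain ⟨n, hn⟩ := (hpot.eventually_lt_const (show 0 < κ * (ε / 2) ^ 2 by positivity)).exists
  have hn0 : (0 : ℝ) ≤ φ n := Nat.cast_nonneg _
  refine ⟨φ n, fun t ht => ?_⟩
  rw [Real.dist_eq]
  by_contra! hfar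
  have ht0 := hn0.trans ht
  have h1 := h (w t i) (hC t ht0 i) (by linarith)
  have h2 := hdecr hx hn0 ht
  have h3 := mul_nonneg (sub_nonneg.2 ht) (hG0 fun i => ρ (w t i))
  have h4 := hsingle x t i
  have h5 : κ * (ε / 2) ^ 2 ≤ κ * (|w t i - x i| - ε / 2) ^ 2 := by
    gcongr
    linarith
  linarith

end Flow

/-- A bounded reparametrized trajectory on `[0,∞)` converges to a point of
the closure of `D_rp^N` at which the loss vanishes. -/
theorem statement9 {N M : ℕ} (ρ ρinv : ℝ → ℝ) (D : Set ℝ) (hA2 : RepA2 ρ D ρinv)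
    (A : Matrix (Fin M) (Fin N) ℝ) (y : Fin M → ℝ)
    (L : (Fin M → ℝ) → (Fin M → ℝ) → ℝ) (hA3 : LossA3 L)
    (zt0 : Fin N → ℝ) (hzt0mem : ∀ i, zt0 i ∈ D) (hzt0 : A.mulVec zt0 = y)
    (w : ℝ → Fin N → ℝ)
    (hflow : IsGradFlowOn (fun z => L (A.mulVec fun i => ρ (z i)) y) ⊤ w)
    (hreg : RegularFlow ρ ⊤ w)
    (hbdd : ∃ C : ℝ, ∀ t : ℝ, 0 ≤ t → euclNorm (fun i => ρ (w t i)) ≤ C) :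
    ∃ winf : Fin N → ℝ, (∀ i, winf i ∈ closure D) ∧
      Tendsto (fun t => fun i => ρ (w t i)) atTop (𝓝 winf) ∧
      L (A.mulVec winf) y = 0 := by
  obtain ⟨C, hC⟩ := hbdd
  have habs : ∀ t, 0 ≤ t → ∀ i, |ρ (w t i)| ≤ C := fun t ht i => by
    refine le_trans (Real.abs_le_sqrt ?_) (hC t ht)
    exact Finset.single_le_sum (f := fun i => (ρ (w t i)) ^ 2)
      (fun j _ => sq_nonneg _) (Finset.mem_univ i)
  have hL : ContDiff ℝ 1 fun u => L u y :=
    hA3.contDiff.comp (contDiff_id.prodMk contDiff_const)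
  have hG : ContDiff ℝ 1 fun z => L (A.mulVec z) y :=
    hL.comp A.mulVecLin.toContinuousLinearMap.contDiff
  have hconv : ConvexOn ℝ univ fun z => L (A.mulVec z) y :=
    (hA3.convexOn_fst y).comp_linearMap A.mulVecLin
  have hb : L (A.mulVec fun i => ρ (ρinv (zt0 i))) y = 0 := by
    rw [hA3.eq_zero_iff, ← hzt0]
    congr 1
    exact funext fun i => hA2.right_inv _ (hzt0mem i)
  have hint := hA2.intervalIntegrable_inv_deriv
  have hlim : ∃ x : Fin N → ℝ, Tendsto w atTop (𝓝 x) ∧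
      L (A.mulVec fun i => ρ (x i)) y = 0 := by
    rcases hA2.contDiff.continuous.strictMono_of_inj
      (Function.LeftInverse.injective hA2.left_inv) with hmono | hanti
    · exact exists_tendsto_of_strictMono hA2.contDiff hmono hA2.finite_critical hint hG hconv
        (fun z => hA3.nonneg _ _) hflow hreg hb habs
    · have hderiv : deriv (fun s => -ρ s) = fun s => -deriv ρ s := funext fun s => deriv.fun_neg
      have hneg : ∀ u : Fin N → ℝ, (-fun i => -ρ (u i)) = fun i => ρ (u i) :=
        fun u => funext fun i => neg_neg _
      have := exists_tendsto_of_strictMono (ρ := fun s => -ρ s)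
        (G := fun z => L (A.mulVec (-z)) y) (w := w) (b := fun i => ρinv (zt0 i)) (C := C)
        hA2.contDiff.neg hanti.neg (by simpa [hderiv] using hA2.finite_critical)
        (fun a b => by
          simp only [hderiv, inv_neg]
          exact (hint a b).neg)
        (hG.comp contDiff_neg)
        (hconv.comp_linearMap (-LinearMap.id : (Fin N → ℝ) →ₗ[ℝ] (Fin N → ℝ)))
        (fun z => hA3.nonneg _ _) (by simpa only [hneg] using hflow)
        (by simpa only [RegularFlow, hderiv, neg_eq_zero] using hreg)
        (by simpa only [hneg] using hb) (by simpa only [abs_neg] using habs)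
      simpa only [hneg] using this
  obtain ⟨x, hx, hx0⟩ := hlim
  refine ⟨fun i => ρ (x i), fun i => subset_closure (hA2.mapsTo _), ?_, hx0⟩
  exact tendsto_pi_nhds.2 fun i =>
    (hA2.contDiff.continuous.tendsto _).comp (tendsto_pi_nhds.1 hx i)
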